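/- arXiv:2104.01187 — 2 statements merged into one kernel-verified Lean document; each statement's English description precedes it below -/
import Mathlib

section
/- Assume Φ_n^{a,b,N;M,U} ≠ 0 for every n = 0,…,n_S. Then there exist complex numbers b_n such that for every n with 1 ≤ n ≤ n_S−2 and every complex x, x·q_n^{a,b,N;M,U}(x) = a_{n+1}·q_{n+1}^{a,b,N;M,U}(x) + b_n·q_n^{a,b,N;M,U}(x) + c_n·q_{n−1}^{a,b,N;M,U}(x), where a_{n+1} = (n+1+n_U)·Φ_n^{a,b,N;M,U}/Φ_{n+1}^{a,b,N;M,U} and c_n = n·(a+N−n+1)·(a+b+N−n+1)·((a+b+N−n)/(a+b+N−n+1))^a·Φ_{n+1}^{a,b,N;M,U}/Φ_n^{a,b,N;M,U}. -/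
noncomputable section

open Finset

/-- Pochhammer symbol `(x)_m = x (x+1) ⋯ (x+m-1)`. -/
def poch (x : ℝ) (m : ℕ) : ℝ := ∏ i ∈ Finset.range m, (x + i)

/-- Complex Pochhammer symbol. -/
def pochC (x : ℂ) (m : ℕ) : ℂ := ∏ i ∈ Finset.range m, (x + i)

/-- `λ^{a,b}(x) = x (x + a + b + 1)`. -/
def lam (a b : ℕ) (x : ℝ) : ℝ := x * (x + a + b + 1)

/-- Complex version of `λ^{a,b}`. -/
def lamC (a b : ℕ) (x : ℂ) : ℂ := x * (x + a + b + 1)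

/-- Hahn polynomial `h_n^{α,β,ν}(x)`. -/
def hahn (α β ν : ℝ) (n : ℕ) (x : ℝ) : ℝ :=
  ∑ j ∈ Finset.range (n + 1),
    poch (-(n : ℝ)) j * poch (α + β + n + 1) j * poch (-ν + j) (n - j) *
      poch (α + j + 1) (n - j) * poch (-x) j / (Nat.factorial j : ℝ)

/-- Dual Hahn polynomial `R_n^{α,β,ν}(x)` for `n : ℕ`. -/
def dualHahnNat (α β ν : ℝ) (n : ℕ) (x : ℝ) : ℝ :=
  ∑ j ∈ Finset.range (n + 1),
    poch (-(n : ℝ)) j * poch (-ν + j) (n - j) * poch (α + j + 1) (n - j) /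
        ((Nat.factorial n : ℝ) * (-1) ^ j * (Nat.factorial j : ℝ)) *
      ∏ i ∈ Finset.range j, (x - i * (α + β + 1 + i))

/-- Dual Hahn polynomial with the convention `R_k ≡ 0` for `k < 0`. -/
def dualHahn (α β ν : ℝ) (k : ℤ) (x : ℝ) : ℝ :=
  if k < 0 then 0 else dualHahnNat α β ν k.toNat x

/-- Complex dual Hahn polynomial. -/
def dualHahnNatC (α β ν : ℂ) (n : ℕ) (x : ℂ) : ℂ :=
  ∑ j ∈ Finset.range (n + 1),
    pochC (-(n : ℂ)) j * pochC (-ν + j) (n - j) * pochC (α + j + 1) (n - j) /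
        ((Nat.factorial n : ℂ) * (-1) ^ j * (Nat.factorial j : ℂ)) *
      ∏ i ∈ Finset.range j, (x - i * (α + β + 1 + i))

/-- Complex dual Hahn polynomial with the convention `R_k ≡ 0` for `k < 0`. -/
def dualHahnC (α β ν : ℂ) (k : ℤ) (x : ℂ) : ℂ :=
  if k < 0 then 0 else dualHahnNatC α β ν k.toNat x

/-- `⌈(a+b)/2⌉`. -/
def ceilHalf (a b : ℕ) : ℕ := (a + b + 1) / 2

/-- The auxiliary polynomials `W_g^{a,b,N;𝓜}(x)`; the third parameter is allowed to be any
real number (so that triples like `(a, b, -2-N-a-b)` can be used). -/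
def W (a b : ℕ) (Nr : ℝ) (M : ℕ → ℝ) (g : ℕ) (x : ℝ) : ℝ :=
  if a ≤ g ∧ g ≤ a + b - 1 then
    (-1 : ℝ) ^ (b + g) * (Nat.factorial (g - b) : ℝ) *
      ((Nat.factorial (a + b - g - 1) : ℝ) * poch (-x) a *
          hahn (a : ℝ) (-(b : ℝ)) (-2 - Nr - a) (g - a) (x - a) +
        (Nat.factorial (g - a) : ℝ) * poch (Nr + a + b + 1 - g) (2 * g - a - b + 1) / M (g - a) *
          hahn (-(a : ℝ)) (-(b : ℝ)) (-2 - Nr) (a + b - g - 1) x)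
  else if ceilHalf a b ≤ g ∧ g + 1 ≤ a then
    deriv (fun s : ℝ =>
      hahn (-(a : ℝ) - s) (-(b : ℝ)) (-2 - Nr) g x -
        hahn (-(a : ℝ) - s) (-(b : ℝ)) (-2 - Nr) g 0 /
            hahn (-(a : ℝ) - s) (-(b : ℝ)) (-2 - Nr) (a + b - g - 1) 0 *
          hahn (-(a : ℝ) - s) (-(b : ℝ)) (-2 - Nr) (a + b - g - 1) x) 0
  else hahn (-(a : ℝ)) (-(b : ℝ)) (-2 - Nr) g x

/-- The mass `ρ_{b,a,N}(x)` of the dual Hahn measure. -/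
def rhoDH (a b N : ℕ) (x : ℕ) : ℝ :=
  (2 * (x : ℝ) + a + b + 1) * poch ((b : ℝ) + 1) x * poch (-(N : ℝ)) x * (Nat.factorial N : ℝ) /
    ((-1 : ℝ) ^ x * poch ((x : ℝ) + a + b + 1) (N + 1) * poch ((a : ℝ) + 1) x *
      (Nat.factorial x : ℝ))

/-- The mass of the measure `ν_{a,b,N}^{𝓜}` at the point `λ^{a,b}(x)`, for `x = -b, …, N`. -/
def mass (a b N : ℕ) (M : ℕ → ℝ) (x : ℤ) : ℝ :=
  if x < 0 then
    (2 * (x : ℝ) + a + b + 1) * poch ((N : ℝ) + 1 - (x : ℝ)) (x + b).toNat /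
        poch ((N : ℝ) + b + 1) (x + a + 1).toNat * M (x + b).toNat
  else
    (poch ((N : ℝ) + 1) b) ^ 2 / poch ((b : ℝ) + 1) (a - b) * rhoDH a b N x.toNat /
      ∏ i ∈ Finset.range b, (((x : ℝ) + a + i + 1) * ((x : ℝ) + b - i))

/-- The pairing `⟨p, q⟩` with respect to `ν_{a,b,N}^{𝓜}`. -/
def pairing (a b N : ℕ) (M : ℕ → ℝ) (p q : ℝ → ℝ) : ℝ :=
  ∑ x ∈ Finset.Icc (-(b : ℤ)) (N : ℤ),
    mass a b N M x * p (lam a b (x : ℝ)) * q (lam a b (x : ℝ))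

/-- The determinant `Φ_n^{a,b,N;𝓜}`. -/
def PhiM (a b N : ℕ) (M : ℕ → ℝ) (n : ℕ) : ℝ :=
  Matrix.det (Matrix.of fun i j : Fin a =>
    W a b (N : ℝ) M (b + (i : ℕ)) (-(n : ℝ) + ((j : ℕ) : ℝ)))

/-- The polynomial `q_n^{a,b,N;𝓜}(x)` given by the determinantal formula. -/
def qM (a b N : ℕ) (M : ℕ → ℝ) (n : ℕ) (x : ℝ) : ℝ :=
  Matrix.det (Matrix.of fun i j : Fin (a + 1) =>
    if (i : ℕ) = 0 then
      (-1 : ℝ) ^ (j : ℕ) * dualHahn (a : ℝ) (b : ℝ) (N : ℝ) ((n : ℤ) - ((j : ℕ) : ℤ)) x /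
        poch ((b : ℝ) + N - n + (j : ℕ) + 1) (a - (j : ℕ))
    else
      W a b (N : ℝ) M (b + (i : ℕ) - 1) (-(n : ℝ) + ((j : ℕ) : ℝ) - 1))
/-- Mass of the Christoffel transform `ν_{a,b,N}^{𝓜,U}` (complex `U`, given by an
enumeration `u : Fin nU → ℂ`). -/
def massU (a b N : ℕ) (M : ℕ → ℝ) {nU : ℕ} (u : Fin nU → ℂ) (x : ℤ) : ℂ :=
  (∏ k, (lamC a b (x : ℂ) - lamC a b (u k))) * ((mass a b N M x : ℝ) : ℂ)

/-- The pairing `⟨p, q⟩_U`. -/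
def pairU (a b N : ℕ) (M : ℕ → ℝ) {nU : ℕ} (u : Fin nU → ℂ) (p q : ℂ → ℂ) : ℂ :=
  ∑ x ∈ Finset.Icc (-(b : ℤ)) (N : ℤ),
    massU a b N M u x * p (lamC a b (x : ℂ)) * q (lamC a b (x : ℂ))

/-- `n_S`: the number of points `λ^{a,b}(i)`, `-b ≤ i ≤ N`, not of the form `λ^{a,b}(u)`,
`u ∈ U`. -/
def nSU (a b N : ℕ) {nU : ℕ} (u : Fin nU → ℂ) : ℕ :=
  ((Finset.Icc (-(b : ℤ)) (N : ℤ)).filter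
    (fun x : ℤ => ∀ k, lamC a b (x : ℂ) ≠ lamC a b (u k))).card

/-- The determinant `Φ_n^{a,b,N;𝓜,U}`. -/
def PhiU (a b N : ℕ) (M : ℕ → ℝ) {nU : ℕ} (u : Fin nU → ℂ) (n : ℕ) : ℂ :=
  Matrix.det (Matrix.of fun i j : Fin (a + nU) =>
    if h : (i : ℕ) < a then
      ((poch ((b : ℝ) + N - n - nU + (j : ℕ) + 2) (a + nU - (j : ℕ) - 1) *
          W a b (N : ℝ) M (b + (i : ℕ)) (-(n : ℝ) - nU + ((j : ℕ) : ℝ)) : ℝ) : ℂ)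
    else
      (-1 : ℂ) ^ ((j : ℕ) + 1) *
        dualHahnC (a : ℂ) (b : ℂ) (N : ℂ) ((n : ℤ) + nU - (j : ℕ) - 1)
          (lamC a b (u ⟨(i : ℕ) - a, by have := i.isLt; omega⟩)))

/-- The determinant in the numerator of `q_n^{a,b,N;𝓜,U}`. -/
def DU (a b N : ℕ) (M : ℕ → ℝ) {nU : ℕ} (u : Fin nU → ℂ) (n : ℕ) (x : ℂ) : ℂ :=
  Matrix.det (Matrix.of fun i j : Fin (a + nU + 1) =>
    if _h0 : (i : ℕ) = 0 then
      (-1 : ℂ) ^ (j : ℕ) * dualHahnC (a : ℂ) (b : ℂ) (N : ℂ) ((n : ℤ) + nU - (j : ℕ)) x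
    else if _h1 : (i : ℕ) ≤ a then
      ((poch ((b : ℝ) + N - n - nU + (j : ℕ) + 1) (a + nU - (j : ℕ)) *
          W a b (N : ℝ) M (b + (i : ℕ) - 1) (-(n : ℝ) - nU + ((j : ℕ) : ℝ) - 1) : ℝ) : ℂ)
    else
      (-1 : ℂ) ^ (j : ℕ) *
        dualHahnC (a : ℂ) (b : ℂ) (N : ℂ) ((n : ℤ) + nU - (j : ℕ))
          (lamC a b (u ⟨(i : ℕ) - a - 1, by have := i.isLt; omega⟩)))

/-- The rational function `q_n^{a,b,N;𝓜,U}(x)`. -/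
def qU (a b N : ℕ) (M : ℕ → ℝ) {nU : ℕ} (u : Fin nU → ℂ) (n : ℕ) (x : ℂ) : ℂ :=
  DU a b N M u n x / ∏ k, (x - lamC a b (u k))

/-- The determinant `Ψ_n^{a,b,N;𝓜,U}`. -/
def PsiU (a b N : ℕ) (M : ℕ → ℝ) {nU : ℕ} (u : Fin nU → ℂ) (n : ℕ) : ℂ :=
  Matrix.det (Matrix.of fun i j : Fin (b + nU) =>
    if _h2 : (i : ℕ) < b then
      ((poch (-(N : ℝ) - a - b) (n + (j : ℕ)) *
          W a b (-2 - (N : ℝ) - a - b) (fun t => 1 / M t) (a + (i : ℕ))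
            ((N : ℝ) + a + b - n - (j : ℕ)) : ℝ) : ℂ)
    else
      dualHahnC (b : ℂ) (a : ℂ) (N : ℂ) ((n : ℤ) - b + (j : ℕ))
        (lamC a b (u ⟨(i : ℕ) - b, by have := i.isLt; omega⟩)))

/-- The determinant in the numerator of `r_n^{a,b,N;𝓜,U}`. -/
def EU (a b N : ℕ) (M : ℕ → ℝ) {nU : ℕ} (u : Fin nU → ℂ) (n : ℕ) (x : ℂ) : ℂ :=
  Matrix.det (Matrix.of fun i j : Fin (b + nU + 1) =>
    if _h3 : (i : ℕ) = 0 then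
      dualHahnC (b : ℂ) (a : ℂ) (N : ℂ) ((n : ℤ) - b + (j : ℕ)) x
    else if _h4 : (i : ℕ) ≤ b then
      ((poch (-(N : ℝ) - a - b) (n + (j : ℕ)) *
          W a b (-2 - (N : ℝ) - a - b) (fun t => 1 / M t) (a + (i : ℕ) - 1)
            ((N : ℝ) + a + b - n - (j : ℕ)) : ℝ) : ℂ)
    else
      dualHahnC (b : ℂ) (a : ℂ) (N : ℂ) ((n : ℤ) - b + (j : ℕ))
        (lamC a b (u ⟨(i : ℕ) - b - 1, by have := i.isLt; omega⟩)))

/-- The rational function `r_n^{a,b,N;𝓜,U}(x)`. -/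
def rU (a b N : ℕ) (M : ℕ → ℝ) {nU : ℕ} (u : Fin nU → ℂ) (n : ℕ) (x : ℂ) : ℂ :=
  EU a b N M u n x / ∏ k, (x - lamC a b (u k))

theorem poch_succ (x : ℝ) (m : ℕ) : poch x (m + 1) = poch x m * (x + m) :=
  Finset.prod_range_succ _ _

theorem poch_succ_left (x : ℝ) (m : ℕ) : poch x (m + 1) = x * poch (x + 1) m := by
  unfold poch
  rw [Finset.prod_range_succ', mul_comm]
  congr 1
  · simp
  · refine Finset.prod_congr rfl fun i _ => ?_
    push_cast
    ring

theorem poch_add (x : ℝ) (d e : ℕ) : poch x (d + e) = poch x d * poch (x + d) e := by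
  unfold poch
  rw [Finset.prod_range_add]
  congr 1
  exact Finset.prod_congr rfl fun i _ => by push_cast; ring

theorem pochC_succ (x : ℂ) (m : ℕ) : pochC x (m + 1) = pochC x m * (x + m) :=
  Finset.prod_range_succ _ _

theorem pochC_succ_left (x : ℂ) (m : ℕ) : pochC x (m + 1) = x * pochC (x + 1) m := by
  unfold pochC
  rw [Finset.prod_range_succ', mul_comm]
  congr 1
  · simp
  · refine Finset.prod_congr rfl fun i _ => ?_
    push_cast
    ring

theorem poch_zero (x : ℝ) : poch x 0 = 1 := rfl

theorem pochC_zero (x : ℂ) : pochC x 0 = 1 := rfl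

theorem poch_ne_zero {x : ℝ} {m : ℕ} (h : ∀ i, i < m → x + i ≠ 0) : poch x m ≠ 0 :=
  Finset.prod_ne_zero_iff.2 fun i hi => h i (Finset.mem_range.1 hi)

theorem poch_neg_natCast_of_lt {n j : ℕ} (h : n < j) : poch (-(n : ℝ)) j = 0 :=
  Finset.prod_eq_zero (Finset.mem_range.2 h) (by simp)

theorem pochC_neg_natCast_of_lt {n j : ℕ} (h : n < j) : pochC (-(n : ℂ)) j = 0 :=
  Finset.prod_eq_zero (Finset.mem_range.2 h) (by simp)

/-- The second order difference operator of the Hahn polynomials. -/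
def hahnOp (α β ν : ℝ) (w : ℝ → ℝ) (x : ℝ) : ℝ :=
  (x + α + 1) * (x - ν) * (w (x + 1) - w x) + x * (x - β - ν - 1) * (w (x - 1) - w x)

/-- The operator `hahnOp` is two-diagonal on the basis `(-x)_j`. -/
theorem hahnOp_poch_succ (α β ν : ℝ) (j : ℕ) (x : ℝ) :
    hahnOp α β ν (fun t => poch (-t) (j + 1)) x =
      -((j + 1) * (α + j + 1) * (j - ν)) * poch (-x) j +
        (j + 1) * (α + β + j + 2) * poch (-x) (j + 1) := by
  have h1 : poch (-(x + 1)) (j + 1) = (-x - 1) * poch (-x) j := by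
    rw [poch_succ_left, show -(x + 1) + 1 = -x by ring, show -(x + 1) = -x - 1 by ring]
  have h2 : poch (-(x - 1)) (j + 1) = poch (-x + 1) j * (-x + 1 + j) := by
    rw [poch_succ, show -(x - 1) = -x + 1 by ring]
  have h3 := poch_succ (-x) j
  have h4 := poch_succ_left (-x) j
  have h5 : x * poch (-x + 1) j = -(poch (-x) j * (-x + j)) := by
    linear_combination h4 - h3
  simp only [hahnOp]
  rw [h1, h2, h3]
  linear_combination (x - β - ν - 1) * (-x + 1 + j) * h5

/-- The difference equation of the Hahn polynomials. -/
theorem hahnOp_hahn (α β ν : ℝ) (n : ℕ) (x : ℝ) :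
    hahnOp α β ν (hahn α β ν n) x = n * (n + α + β + 1) * hahn α β ν n x := by
  set t : ℕ → ℝ := fun j => poch (-(n : ℝ)) j * poch (α + β + n + 1) j * poch (-ν + j) (n - j) *
      poch (α + j + 1) (n - j) / (Nat.factorial j : ℝ) with ht
  have hh : ∀ y, hahn α β ν n y = ∑ j ∈ Finset.range (n + 1), t j * poch (-y) j := fun y =>
    Finset.sum_congr rfl fun j _ => by simp only [ht]; ring
  have hop : hahnOp α β ν (hahn α β ν n) x =
      ∑ j ∈ Finset.range (n + 1), t j * hahnOp α β ν (fun y => poch (-y) j) x := by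
    simp only [hahnOp, hh, ← Finset.sum_sub_distrib, Finset.mul_sum, ← Finset.sum_add_distrib]
    exact Finset.sum_congr rfl fun j _ => by ring
  set v : ℕ → ℝ := fun j => t (j + 1) * ((j + 1) * (α + j + 1) * (j - ν)) * poch (-x) j with hv
  have hrec : ∀ j, j < n → t j * ((j - n) * (j + n + α + β + 1)) * poch (-x) j = v j := by
    intro j hj
    obtain ⟨d, rfl⟩ := Nat.exists_eq_add_of_lt hj
    simp only [hv, ht]
    rw [show j + d + 1 - j = d + 1 by omega, show j + d + 1 - (j + 1) = d by omega,
      poch_succ_left (-ν + j), poch_succ_left (α + j + 1), poch_succ _ j, poch_succ _ j,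
      Nat.factorial_succ]
    have e1 : (-ν + (j : ℝ) + 1) = -ν + ((j + 1 : ℕ) : ℝ) := by push_cast; ring
    have e2 : (α + (j : ℝ) + 1 + 1) = α + ((j + 1 : ℕ) : ℝ) + 1 := by push_cast; ring
    rw [e1, e2]
    have : (j.factorial : ℝ) ≠ 0 := by positivity
    push_cast
    field_simp
    ring
  rw [hop, hh, Finset.mul_sum, ← sub_eq_zero, ← Finset.sum_sub_distrib]
  have hterm : ∀ j ∈ Finset.range (n + 1),
      t j * hahnOp α β ν (fun y => poch (-y) j) x - n * (n + α + β + 1) * (t j * poch (-x) j) =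
        (if j = n then 0 else v j) - (if j = 0 then 0 else v (j - 1)) := by
    intro j hj
    have hA : t j * ((j - n) * (j + n + α + β + 1)) * poch (-x) j = if j = n then 0 else v j := by
      split_ifs with h
      · rw [h]; ring
      · exact hrec j (by have := Finset.mem_range.1 hj; omega)
    rw [← hA]
    rcases j with _ | j
    · simp [hahnOp, poch_zero]
      ring
    · rw [hahnOp_poch_succ]
      simp only [hv]
      push_cast
      simp
      ring
  rw [Finset.sum_congr rfl hterm, Finset.sum_sub_distrib, Finset.sum_range_succ,
    Finset.sum_range_succ']
  simp only [if_true, Nat.add_sub_cancel, Nat.succ_ne_zero, if_false, add_zero]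
  rw [sub_eq_zero]
  exact Finset.sum_congr rfl fun j hj => if_neg (Finset.mem_range.1 hj).ne

theorem hahnOp_poch_mul (a : ℕ) (β ν : ℝ) (w : ℝ → ℝ) (x : ℝ) :
    hahnOp (-a) β ν (fun t => poch (-t) a * w (t - a)) x =
      poch (-x) a * (hahnOp a β (ν - a) w (x - a) + a * (β + 1) * w (x - a)) := by
  have h1 : (-x - 1 + a) * poch (-(x + 1)) a = (-x - 1) * poch (-x) a := by
    have h := poch_succ (-(x + 1)) a
    rw [poch_succ_left, show -(x + 1) + 1 = -x by ring] at h
    linear_combination -h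
  have h2 : -x * poch (-(x - 1)) a = poch (-x) a * (-x + a) := by
    have h := poch_succ_left (-x) a
    rw [poch_succ] at h
    rw [show -(x - 1) = -x + 1 by ring]
    exact h.symm
  simp only [hahnOp]
  rw [show x + 1 - a = x - a + 1 by ring, show x - 1 - a = x - a - 1 by ring]
  linear_combination -(x - ν) * w (x - a + 1) * h1 - (x - β - ν - 1) * w (x - a - 1) * h2

theorem hahn_apply_zero (α β ν : ℝ) (n : ℕ) :
    hahn α β ν n 0 = poch (-ν) n * poch (α + 1) n := by
  unfold hahn
  rw [Finset.sum_eq_single 0]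
  · simp [poch_zero]
  · intro j _ hj
    have : poch (-0 : ℝ) j = 0 :=
      Finset.prod_eq_zero (Finset.mem_range.2 (Nat.pos_of_ne_zero hj)) (by simp)
    rw [this]
    simp
  · simp

theorem differentiable_poch {f : ℝ → ℝ} (hf : Differentiable ℝ f) (m : ℕ) :
    Differentiable ℝ fun s => poch (f s) m := by
  unfold poch
  fun_prop

theorem differentiable_hahn {f : ℝ → ℝ} (hf : Differentiable ℝ f) (β ν : ℝ) (n : ℕ) (x : ℝ) :
    Differentiable ℝ fun s => hahn (f s) β ν n x := by
  unfold hahn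
  refine Differentiable.fun_sum fun j _ => ?_
  have h1 : Differentiable ℝ fun s => poch (f s + β + n + 1) j :=
    differentiable_poch (f := fun s => f s + β + n + 1) (by fun_prop) j
  have h2 : Differentiable ℝ fun s => poch (f s + j + 1) (n - j) :=
    differentiable_poch (f := fun s => f s + j + 1) (by fun_prop) (n - j)
  fun_prop

theorem hahnOp_const_mul (α β ν c : ℝ) (w : ℝ → ℝ) (x : ℝ) :
    hahnOp α β ν (fun t => c * w t) x = c * hahnOp α β ν w x := by
  simp only [hahnOp]
  ring

theorem hahnOp_add (α β ν : ℝ) (v w : ℝ → ℝ) (x : ℝ) :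
    hahnOp α β ν (fun t => v t + w t) x = hahnOp α β ν v x + hahnOp α β ν w x := by
  simp only [hahnOp]
  ring

theorem hahnOp_sub (α β ν : ℝ) (v w : ℝ → ℝ) (x : ℝ) :
    hahnOp α β ν (fun t => v t - w t) x = hahnOp α β ν v x - hahnOp α β ν w x := by
  simp only [hahnOp]
  ring

/-- For `α + β = -(g + g' + 1)` with `g' ≤ g`, the Hahn polynomials of degree indices `g` and `g'`
are proportional. -/
theorem hahn_reflect {α β ν : ℝ} {g g' : ℕ} (hαβ : α + β = -(g + g' + 1 : ℝ)) (hg : g' ≤ g)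
    (x : ℝ) :
    hahn α β ν g x = poch (-ν + g') (g - g') * poch (α + g' + 1) (g - g') * hahn α β ν g' x := by
  unfold hahn
  rw [Finset.mul_sum]
  symm
  apply Finset.sum_subset_zero_on_sdiff (Finset.range_subset_range.2 (by omega))
  · intro j hj
    have : g' < j := by
      have := (Finset.mem_sdiff.1 hj).2
      rw [Finset.mem_range] at this
      omega
    rw [show α + β + g + 1 = -(g' : ℝ) by linarith, poch_neg_natCast_of_lt this]
    ring
  · intro j hj
    have hj' : j ≤ g' := by have := Finset.mem_range.1 hj; omega
    rw [show α + β + g + 1 = -(g' : ℝ) by linarith, show α + β + g' + 1 = -(g : ℝ) by linarith,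
      show g - j = (g' - j) + (g - g') by omega, poch_add (-ν + j), poch_add (α + j + 1),
      Nat.cast_sub hj', show -ν + j + ((g' : ℝ) - j) = -ν + g' by ring,
      show α + j + 1 + ((g' : ℝ) - j) = α + g' + 1 by ring]
    ring

/-- The derivative family of Hahn polynomials is a generalised eigenfunction of `hahnOp`. -/
theorem hahnOp_deriv_hahn {a b g g' : ℕ} {ν : ℝ} (hν : ν < 0) (hgg : g + g' + 1 = a + b)
    (hle : g' ≤ g) (hga : g < a) (x : ℝ) :
    hahnOp (-a) (-b) ν (fun y => deriv (fun s : ℝ =>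
      hahn (-(a : ℝ) - s) (-b) ν g y - hahn (-(a : ℝ) - s) (-b) ν g 0 /
        hahn (-(a : ℝ) - s) (-b) ν g' 0 * hahn (-(a : ℝ) - s) (-b) ν g' y) 0) x =
      g * (g - a - b + 1) * deriv (fun s : ℝ =>
      hahn (-(a : ℝ) - s) (-b) ν g x - hahn (-(a : ℝ) - s) (-b) ν g 0 /
        hahn (-(a : ℝ) - s) (-b) ν g' 0 * hahn (-(a : ℝ) - s) (-b) ν g' x) 0 +
      hahn (-a) (-b) ν g 0 / hahn (-a) (-b) ν g' 0 * (g' - g) * hahn (-a) (-b) ν g' x := by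
  set r : ℝ → ℝ := fun s => hahn (-(a : ℝ) - s) (-b) ν g 0 / hahn (-(a : ℝ) - s) (-b) ν g' 0 with hr
  set F : ℝ → ℝ → ℝ := fun y s => hahn (-(a : ℝ) - s) (-b) ν g y -
    r s * hahn (-(a : ℝ) - s) (-b) ν g' y with hF
  have hcast : (g : ℝ) + g' + 1 = a + b := by exact_mod_cast hgg
  have hne : hahn (-(a : ℝ) - 0) (-b) ν g' 0 ≠ 0 := by
    rw [hahn_apply_zero, sub_zero]
    refine mul_ne_zero (poch_ne_zero fun i _ => ?_) (poch_ne_zero fun i hi => ?_)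
    · have : (0 : ℝ) ≤ i := by positivity
      linarith
    · have : (i : ℝ) + 1 < a := by exact_mod_cast (by omega : i + 1 < a)
      linarith
  have hdiff : ∀ n y, Differentiable ℝ fun s => hahn (-(a : ℝ) - s) (-b) ν n y := fun n y =>
    differentiable_hahn (f := fun s => -(a : ℝ) - s) (by fun_prop) _ _ _ _
  have hrd : DifferentiableAt ℝ r 0 := ((hdiff g 0) 0).div ((hdiff g' 0) 0) hne
  have hFd : ∀ y, HasDerivAt (F y) (deriv (F y) 0) 0 := fun y =>
    (((hdiff g y) 0).sub (hrd.mul ((hdiff g' y) 0))).hasDerivAt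
  have hF0 : ∀ y, F y 0 = 0 := by
    intro y
    have href := hahn_reflect (α := -(a : ℝ) - 0) (β := -b) (ν := ν) (g := g) (g' := g')
      (by linarith) hle
    simp only [hF, hr]
    rw [href y, href 0, mul_div_assoc, div_self hne]
    ring
  have heq : ∀ s, hahnOp (-(a : ℝ) - s) (-b) ν (fun y => F y s) x =
      g * (g + (-(a : ℝ) - s) + -b + 1) * F x s +
        s * (g' - g) * (r s * hahn (-(a : ℝ) - s) (-b) ν g' x) := by
    intro s
    simp only [hF]
    rw [hahnOp_sub, hahnOp_const_mul, hahnOp_hahn, hahnOp_hahn]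
    have hb' : (b : ℝ) = g + g' + 1 - a := by linarith
    rw [hb']
    ring
  have hL : HasDerivAt (fun s => hahnOp (-(a : ℝ) - s) (-b) ν (fun y => F y s) x)
      (hahnOp (-a) (-b) ν (fun y => deriv (F y) 0) x) 0 := by
    simp only [hahnOp]
    have h1 : HasDerivAt (fun s : ℝ => (x + (-(a : ℝ) - s) + 1) * (x - ν)) (-(x - ν)) 0 := by
      have := (((hasDerivAt_id (0 : ℝ)).const_sub (-(a : ℝ))).const_add x).add_const 1
      simpa using this.mul_const (x - ν)
    have h2 := (h1.mul ((hFd (x + 1)).sub (hFd x))).add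
      (((hFd (x - 1)).sub (hFd x)).const_mul (x * (x - -(b : ℝ) - ν - 1)))
    refine h2.congr_deriv ?_
    simp [hF0]
  have hR : HasDerivAt (fun s => g * (g + (-(a : ℝ) - s) + -b + 1) * F x s +
        s * (g' - g) * (r s * hahn (-(a : ℝ) - s) (-b) ν g' x))
      (g * (g - a - b + 1) * deriv (F x) 0 + r 0 * (g' - g) * hahn (-a) (-b) ν g' x) 0 := by
    have h1 : HasDerivAt (fun s : ℝ => (g : ℝ) * (g + (-(a : ℝ) - s) + -b + 1)) (-g) 0 := by
      have := ((((hasDerivAt_id (0 : ℝ)).const_sub (-(a : ℝ))).const_add (g : ℝ)).add_const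
        (-(b : ℝ))).add_const 1
      simpa using this.const_mul (g : ℝ)
    have h2 : HasDerivAt (fun s : ℝ => s * ((g' : ℝ) - g)) (g' - g) 0 := by
      simpa using (hasDerivAt_id (0 : ℝ)).mul_const ((g' : ℝ) - g)
    have h3 := (hrd.mul ((hdiff g' x) 0)).hasDerivAt
    refine ((h1.mul (hFd x)).add (h2.mul h3)).congr_deriv ?_
    simp [hF0]
    ring
  rw [funext heq] at hL
  have := hL.unique hR
  simpa [hr] using this

/-- The span of the `W_g` with `b ≤ g < a + b` is invariant under the Hahn operator. -/
theorem exists_hahnOp_W {a b : ℕ} (N : ℕ) (M : ℕ → ℝ) {i : ℕ} (hi : i < a) :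
    ∃ (μ η : ℝ) (l : ℕ), l < a ∧ ∀ x, hahnOp (-a) (-b) (-2 - N) (W a b N M (b + i)) x =
      μ * W a b N M (b + i) x + η * W a b N M (b + l) x := by
  by_cases h1 : a ≤ b + i ∧ b + i ≤ a + b - 1
  · refine ⟨(b + i) * (b + i - a - b + 1), 0, i, hi, fun x => ?_⟩
    have hW : W a b N M (b + i) = fun x => (-1 : ℝ) ^ (b + (b + i)) *
        (Nat.factorial (b + i - b) : ℝ) * ((Nat.factorial (a + b - (b + i) - 1) : ℝ) *
          (poch (-x) a * hahn (a : ℝ) (-(b : ℝ)) (-2 - N - a) (b + i - a) (x - a)) +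
        (Nat.factorial (b + i - a) : ℝ) *
          poch (N + a + b + 1 - (b + i : ℕ)) (2 * (b + i) - a - b + 1) / M (b + i - a) *
          hahn (-(a : ℝ)) (-(b : ℝ)) (-2 - N) (a + b - (b + i) - 1) x) := by
      funext x
      rw [W, if_pos h1]
      ring
    have c1 : ((b + i - a : ℕ) : ℝ) = b + i - a := by
      rw [Nat.cast_sub h1.1]
      push_cast
      ring
    have c2 : ((a + b - (b + i) - 1 : ℕ) : ℝ) = a - i - 1 := by
      rw [show a + b - (b + i) - 1 = a - (i + 1) by omega, Nat.cast_sub hi]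
      push_cast
      ring
    rw [hW, hahnOp_const_mul, hahnOp_add, hahnOp_const_mul, hahnOp_const_mul,
      hahnOp_poch_mul a (-b) (-2 - N) (hahn a (-b) (-2 - N - a) (b + i - a)), hahnOp_hahn,
      hahnOp_hahn, c1, c2]
    ring
  by_cases h2 : ceilHalf a b ≤ b + i ∧ b + i + 1 ≤ a
  · have hc := h2.1
    unfold ceilHalf at hc
    have hW : W a b N M (b + i) = fun x => deriv (fun s : ℝ =>
        hahn (-(a : ℝ) - s) (-b) (-2 - N) (b + i) x - hahn (-(a : ℝ) - s) (-b) (-2 - N) (b + i) 0 /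
        hahn (-(a : ℝ) - s) (-b) (-2 - N) (a + b - (b + i) - 1) 0 *
          hahn (-(a : ℝ) - s) (-b) (-2 - N) (a + b - (b + i) - 1) x) 0 := by
      funext x
      rw [W, if_neg h1, if_pos h2]
    have hW' : W a b N M (b + (a - (b + i) - 1)) =
        hahn (-a) (-b) (-2 - N) (a + b - (b + i) - 1) := by
      funext x
      rw [W, if_neg (by omega), if_neg (by unfold ceilHalf; omega)]
      congr 1
      omega
    have hν : (-2 - N : ℝ) < 0 := by
      have : (0 : ℝ) ≤ N := by positivity
      linarith
    refine ⟨(b + i : ℕ) * ((b + i : ℕ) - a - b + 1),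
      hahn (-a) (-b) (-2 - N) (b + i) 0 / hahn (-a) (-b) (-2 - N) (a + b - (b + i) - 1) 0 *
        ((a + b - (b + i) - 1 : ℕ) - (b + i : ℕ)), a - (b + i) - 1, by omega, fun x => ?_⟩
    rw [hW', hW]
    exact hahnOp_deriv_hahn hν (by omega) (by omega) (by omega) x
  · have hW : W a b N M (b + i) = hahn (-a) (-b) (-2 - N) (b + i) := by
      funext x
      rw [W, if_neg h1, if_neg h2]
    refine ⟨(b + i : ℕ) * ((b + i : ℕ) + -a + -b + 1), 0, i, hi, fun x => ?_⟩
    rw [hW, hahnOp_hahn, zero_mul, add_zero]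

/-- Coefficient of `R_n` in the three term recurrence of the dual Hahn polynomials. -/
def dualHahnDiag (α β ν k : ℂ) : ℂ := (k + α + 1) * (ν - k) + k * (β + ν + 1 - k)

/-- Coefficient of `R_{n-1}` in the three term recurrence of the dual Hahn polynomials. -/
def dualHahnLower (α β ν k : ℂ) : ℂ := (k + α) * (ν + 1 - k) * (β + ν + 1 - k)

theorem pochC_neg_eq (n d : ℕ) :
    pochC (-((n + d : ℕ) : ℂ)) n * (d.factorial : ℂ) = (-1) ^ n * ((n + d).factorial : ℂ) := by
  induction n with
  | zero => simp [pochC_zero]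
  | succ n ih =>
    rw [pochC_succ_left, show -((n + 1 + d : ℕ) : ℂ) + 1 = -((n + d : ℕ) : ℂ) by push_cast; ring,
      mul_assoc, ih, show n + 1 + d = (n + d) + 1 by omega, Nat.factorial_succ]
    push_cast
    ring

theorem pochC_div_factorial (n d : ℕ) :
    pochC (-((n + d : ℕ) : ℂ)) n / (((n + d).factorial : ℂ) * (-1) ^ n * (n.factorial : ℂ)) =
      1 / ((d.factorial : ℂ) * n.factorial) := by
  have h := pochC_neg_eq n d
  have h1 : (d.factorial : ℂ) ≠ 0 := by exact_mod_cast d.factorial_ne_zero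
  have h2 : (n.factorial : ℂ) ≠ 0 := by exact_mod_cast n.factorial_ne_zero
  have h3 : ((n + d).factorial : ℂ) ≠ 0 := by exact_mod_cast (n + d).factorial_ne_zero
  have h4 : (-1 : ℂ) ^ n ≠ 0 := pow_ne_zero _ (by norm_num)
  rw [div_eq_div_iff (by positivity) (by positivity)]
  linear_combination (n.factorial : ℂ) * h

/-- Coefficient of `R_n` in the basis `∏ i < j, (x - i (α + β + 1 + i))`. -/
def dualHahnCoeff (α ν : ℂ) (n j : ℕ) : ℂ :=
  pochC (-(n : ℂ)) j * pochC (-ν + j) (n - j) * pochC (α + j + 1) (n - j) /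
    ((Nat.factorial n : ℂ) * (-1) ^ j * (Nat.factorial j : ℂ))

theorem dualHahnNatC_eq_sum (α β ν : ℂ) {n K : ℕ} (h : n < K) (x : ℂ) :
    dualHahnNatC α β ν n x = ∑ j ∈ Finset.range K, dualHahnCoeff α ν n j *
      ∏ i ∈ Finset.range j, (x - i * (α + β + 1 + i)) := by
  refine Finset.sum_subset (Finset.range_subset_range.2 (by omega)) fun j _ hj => ?_
  rw [pochC_neg_natCast_of_lt (by simpa using hj)]
  simp

theorem dualHahnCoeff_add (α ν : ℂ) (j d : ℕ) :
    dualHahnCoeff α ν (j + d) j = pochC (-ν + j) d * pochC (α + j + 1) d *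
      (1 / ((d.factorial : ℂ) * j.factorial)) := by
  rw [← pochC_div_factorial, dualHahnCoeff, Nat.add_sub_cancel_left]
  ring

theorem dualHahnCoeff_of_lt (α ν : ℂ) {n j : ℕ} (h : n < j) : dualHahnCoeff α ν n j = 0 := by
  rw [dualHahnCoeff, pochC_neg_natCast_of_lt h]
  simp

theorem dualHahnCoeff_self (α ν : ℂ) (n : ℕ) :
    dualHahnCoeff α ν n n = 1 / n.factorial := by
  simpa [pochC_zero] using dualHahnCoeff_add α ν n 0

theorem dualHahnCoeff_succ_self (α ν : ℂ) (n : ℕ) :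
    dualHahnCoeff α ν (n + 1) n = (-ν + n) * (α + n + 1) / n.factorial := by
  have := dualHahnCoeff_add α ν n 1
  simp only [pochC_succ, pochC_zero] at this
  simpa [div_eq_mul_inv] using this

theorem dualHahnCoeff_zero_rec (α β ν : ℂ) (n : ℕ) :
    (n + 2) * dualHahnCoeff α ν (n + 2) 0 +
        dualHahnDiag α β ν (n + 1) * dualHahnCoeff α ν (n + 1) 0 +
        dualHahnLower α β ν (n + 1) * dualHahnCoeff α ν n 0 = 0 := by
  have h0 := dualHahnCoeff_add α ν 0 n
  have h1 := dualHahnCoeff_add α ν 0 (n + 1)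
  have h2 := dualHahnCoeff_add α ν 0 (n + 2)
  simp only [zero_add] at h0 h1 h2
  rw [h0, h1, h2]
  simp only [pochC_succ, Nat.factorial_succ, dualHahnDiag, dualHahnLower]
  have : (n.factorial : ℂ) ≠ 0 := by exact_mod_cast n.factorial_ne_zero
  have h3 : (n : ℂ) + 1 ≠ 0 := by exact_mod_cast n.succ_ne_zero
  have h4 : (n : ℂ) + 1 + 1 ≠ 0 := by exact_mod_cast (n + 1).succ_ne_zero
  push_cast
  field_simp
  ring

theorem dualHahnCoeff_rec (α β ν : ℂ) (n j : ℕ) :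
    (n + 2) * dualHahnCoeff α ν (n + 2) (j + 1) +
        dualHahnDiag α β ν (n + 1) * dualHahnCoeff α ν (n + 1) (j + 1) +
        dualHahnLower α β ν (n + 1) * dualHahnCoeff α ν n (j + 1) =
      dualHahnCoeff α ν (n + 1) j + (j + 1) * (α + β + 1 + (j + 1)) *
        dualHahnCoeff α ν (n + 1) (j + 1) := by
  rcases lt_trichotomy n j with h | rfl | h
  · rcases Nat.lt_or_ge (n + 1) j with h' | h'
    · rw [dualHahnCoeff_of_lt _ _ (by omega), dualHahnCoeff_of_lt _ _ (by omega),
        dualHahnCoeff_of_lt _ _ (by omega), dualHahnCoeff_of_lt _ _ (by omega)]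
      ring
    · obtain rfl : j = n + 1 := by omega
      rw [dualHahnCoeff_self, dualHahnCoeff_of_lt _ _ (by omega : n + 1 < n + 1 + 1),
        dualHahnCoeff_of_lt _ _ (by omega : n < n + 1 + 1), dualHahnCoeff_self,
        Nat.factorial_succ (n + 1)]
      have : ((n + 1).factorial : ℂ) ≠ 0 := by exact_mod_cast (n + 1).factorial_ne_zero
      have h4 : (n : ℂ) + 1 + 1 ≠ 0 := by exact_mod_cast (n + 1).succ_ne_zero
      push_cast
      field_simp
      ring
  · rw [dualHahnCoeff_of_lt _ _ (by omega : n < n + 1), dualHahnCoeff_self,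
      dualHahnCoeff_succ_self, dualHahnCoeff_succ_self, Nat.factorial_succ, dualHahnDiag]
    have : (n.factorial : ℂ) ≠ 0 := by exact_mod_cast n.factorial_ne_zero
    have h3 : (n : ℂ) + 1 ≠ 0 := by exact_mod_cast n.succ_ne_zero
    push_cast
    field_simp
    ring
  · obtain ⟨d, rfl⟩ := Nat.exists_eq_add_of_lt h
    have h0 := dualHahnCoeff_add α ν (j + 1) d
    have h1 := dualHahnCoeff_add α ν (j + 1) (d + 1)
    have h2 := dualHahnCoeff_add α ν (j + 1) (d + 2)
    have h3 := dualHahnCoeff_add α ν j (d + 2)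
    rw [show j + 1 + d = j + d + 1 by omega] at h0
    rw [show j + 1 + (d + 1) = j + d + 1 + 1 by omega] at h1
    rw [show j + 1 + (d + 2) = j + d + 1 + 2 by omega] at h2
    rw [show j + (d + 2) = j + d + 1 + 1 by omega] at h3
    rw [h0, h1, h2, h3, pochC_succ_left (-ν + j), pochC_succ_left (α + j + 1)]
    have e1 : (-ν + (j : ℂ) + 1) = -ν + ((j + 1 : ℕ) : ℂ) := by push_cast; ring
    have e2 : (α + (j : ℂ) + 1 + 1) = α + ((j + 1 : ℕ) : ℂ) + 1 := by push_cast; ring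
    rw [e1, e2]
    simp only [pochC_succ, Nat.factorial_succ, dualHahnDiag, dualHahnLower]
    have f1 : (d.factorial : ℂ) ≠ 0 := by exact_mod_cast d.factorial_ne_zero
    have f2 : (j.factorial : ℂ) ≠ 0 := by exact_mod_cast j.factorial_ne_zero
    have f3 : (d : ℂ) + 1 ≠ 0 := by exact_mod_cast d.succ_ne_zero
    have f4 : (d : ℂ) + 1 + 1 ≠ 0 := by exact_mod_cast (d + 1).succ_ne_zero
    have f5 : (j : ℂ) + 1 ≠ 0 := by exact_mod_cast j.succ_ne_zero
    push_cast
    field_simp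
    ring

theorem mul_dualHahnNatC_succ (α β ν : ℂ) (n : ℕ) (x : ℂ) :
    x * dualHahnNatC α β ν (n + 1) x = (n + 2) * dualHahnNatC α β ν (n + 2) x +
      dualHahnDiag α β ν (n + 1) * dualHahnNatC α β ν (n + 1) x +
      dualHahnLower α β ν (n + 1) * dualHahnNatC α β ν n x := by
  set e : ℕ → ℂ := fun j => ∏ i ∈ Finset.range j, (x - i * (α + β + 1 + i)) with he
  have hx : ∀ j, x * e j = e (j + 1) + j * (α + β + 1 + j) * e j := by
    intro j
    simp only [he, Finset.prod_range_succ]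
    ring
  set c := dualHahnCoeff α ν with hc
  have hlhs : x * dualHahnNatC α β ν (n + 1) x =
      ∑ j ∈ Finset.range (n + 3), (c (n + 1) j * e (j + 1) +
        j * (α + β + 1 + j) * c (n + 1) j * e j) := by
    rw [dualHahnNatC_eq_sum α β ν (by omega : n + 1 < n + 3), Finset.mul_sum]
    refine Finset.sum_congr rfl fun j _ => ?_
    linear_combination c (n + 1) j * hx j
  have hlhs' : x * dualHahnNatC α β ν (n + 1) x = ∑ j ∈ Finset.range (n + 3),
      ((if j = 0 then 0 else c (n + 1) (j - 1)) + j * (α + β + 1 + j) * c (n + 1) j) * e j := by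
    rw [hlhs, Finset.sum_add_distrib, Finset.sum_range_succ]
    simp only [add_mul, Finset.sum_add_distrib]
    rw [Finset.sum_range_succ' (fun j => (if j = 0 then 0 else c (n + 1) (j - 1)) * e j)]
    simp only [hc, dualHahnCoeff_of_lt α ν (by omega : n + 1 < n + 2)]
    simp
  rw [hlhs', dualHahnNatC_eq_sum α β ν (by omega : n + 1 < n + 3),
    dualHahnNatC_eq_sum α β ν (by omega : n + 2 < n + 3),
    dualHahnNatC_eq_sum α β ν (by omega : n < n + 3), Finset.mul_sum, Finset.mul_sum,
    Finset.mul_sum, ← Finset.sum_add_distrib, ← Finset.sum_add_distrib]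
  refine Finset.sum_congr rfl fun j _ => ?_
  rcases j with _ | j
  · have := dualHahnCoeff_zero_rec α β ν n
    simp only [if_true, Nat.cast_zero]
    linear_combination -e 0 * this
  · have := dualHahnCoeff_rec α β ν n j
    rw [if_neg (Nat.succ_ne_zero j), Nat.add_sub_cancel]
    push_cast
    linear_combination -e (j + 1) * this

/-- The three term recurrence relation of the dual Hahn polynomials, for all integer indices. -/
theorem mul_dualHahnC (α β ν : ℂ) (k : ℤ) (x : ℂ) :
    x * dualHahnC α β ν k x = (k + 1) * dualHahnC α β ν (k + 1) x +
      dualHahnDiag α β ν k * dualHahnC α β ν k x +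
      dualHahnLower α β ν k * dualHahnC α β ν (k - 1) x := by
  have hnat : ∀ n : ℕ, dualHahnC α β ν n x = dualHahnNatC α β ν n x := fun n => by
    rw [dualHahnC, if_neg (by omega), Int.toNat_natCast]
  have hneg : ∀ l : ℤ, l < 0 → dualHahnC α β ν l x = 0 := fun l hl => by
    rw [dualHahnC, if_pos hl]
  rcases lt_trichotomy k (-1) with h | rfl | h
  · rw [hneg k (by omega), hneg (k + 1) (by omega), hneg (k - 1) (by omega)]
    ring
  · rw [hneg (-1) (by omega), hneg (-1 - 1) (by omega)]
    push_cast
    ring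
  · obtain ⟨n, rfl⟩ := Int.eq_ofNat_of_zero_le (by omega : 0 ≤ k)
    rcases n with _ | n
    · have h1 := hnat 0
      have h2 := hnat 1
      have h3 : dualHahnC α β ν (((0 : ℕ) : ℤ) - 1) x = 0 := hneg _ (by omega)
      have h4 : dualHahnC α β ν (((0 : ℕ) : ℤ) + 1) x = dualHahnNatC α β ν 1 x := h2
      rw [h1, h3, h4]
      simp [dualHahnNatC, dualHahnDiag, Finset.sum_range_succ, pochC]
      ring
    · have h1 := hnat (n + 1)
      have h2 := hnat (n + 2)
      have h3 := hnat n
      have := mul_dualHahnNatC_succ α β ν n x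
      rw [← h1, ← h2, ← h3] at this
      rw [show (((n + 1 : ℕ) : ℤ) + 1) = ((n + 2 : ℕ) : ℤ) by push_cast; ring,
        show (((n + 1 : ℕ) : ℤ) - 1) = (n : ℤ) by push_cast; ring, this]
      push_cast
      ring

/-- The second order difference operator with coefficients `A`, `B`, `C` on bilateral sequences. -/
def triOp (A B C : ℤ → ℂ) (f : ℤ → ℂ) (k : ℤ) : ℂ :=
  A k * f (k + 1) + B k * f k + C k * f (k - 1)

/-- The Casorati determinant of `φ` on the positions `p, p - 1, …, p - m + 1`. -/
def casorati {m : ℕ} (φ : Fin m → ℤ → ℂ) (p : ℤ) : ℂ :=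
  Matrix.det (Matrix.of fun i j : Fin m => φ i (p - (j : ℕ)))

/-- Signed minors of the Casorati matrix along an adjoined first row. -/
def casoratiCofactor {m : ℕ} (φ : Fin m → ℤ → ℂ) (p : ℤ) (j : Fin (m + 1)) : ℂ :=
  (-1) ^ (j : ℕ) * Matrix.det (Matrix.of fun i l : Fin m => φ i (p - (j.succAbove l : ℕ)))

theorem casorati_cons {m : ℕ} (φ : Fin m → ℤ → ℂ) (f : ℤ → ℂ) (p : ℤ) :
    casorati (Fin.cons f φ : Fin (m + 1) → ℤ → ℂ) p =
      ∑ j : Fin (m + 1), f (p - (j : ℕ)) * casoratiCofactor φ p j := by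
  unfold casorati
  rw [Matrix.det_succ_row_zero]
  refine Finset.sum_congr rfl fun j _ => ?_
  have : ((Matrix.of fun i j : Fin (m + 1) =>
      (Fin.cons f φ : Fin (m + 1) → ℤ → ℂ) i (p - (j : ℕ))).submatrix Fin.succ j.succAbove) =
      Matrix.of fun i l : Fin m => φ i (p - (j.succAbove l : ℕ)) := by
    ext i l
    simp
  rw [this, casoratiCofactor]
  simp
  ring

theorem casoratiCofactor_zero {m : ℕ} (φ : Fin m → ℤ → ℂ) (p : ℤ) :
    casoratiCofactor φ p 0 = casorati φ (p - 1) := by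
  unfold casoratiCofactor casorati
  simp only [Fin.val_zero, pow_zero, one_mul, Fin.zero_succAbove, Fin.val_succ]
  congr 1
  ext i j
  simp only [Matrix.of_apply]
  congr 1
  push_cast
  ring

theorem casoratiCofactor_last {m : ℕ} (φ : Fin m → ℤ → ℂ) (p : ℤ) :
    casoratiCofactor φ p (Fin.last m) = (-1) ^ m * casorati φ p := by
  unfold casoratiCofactor casorati
  simp

theorem casorati_cons_self {m : ℕ} (φ : Fin m → ℤ → ℂ) (i : Fin m) (p : ℤ) :
    casorati (Fin.cons (φ i) φ : Fin (m + 1) → ℤ → ℂ) p = 0 := by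
  refine Matrix.det_zero_of_row_eq (i := 0) (j := i.succ) (Fin.succ_ne_zero i).symm ?_
  ext j
  simp

theorem casorati_cons_sub_sum {m : ℕ} {ι : Type*} (s : Finset ι) (φ : Fin m → ℤ → ℂ)
    (f : ℤ → ℂ) (t : ι → ℂ) (g : ι → ℤ → ℂ) (p : ℤ) :
    casorati (Fin.cons (fun k => f k - ∑ i ∈ s, t i * g i k) φ : Fin (m + 1) → ℤ → ℂ) p =
      casorati (Fin.cons f φ : Fin (m + 1) → ℤ → ℂ) p -
        ∑ i ∈ s, t i * casorati (Fin.cons (g i) φ : Fin (m + 1) → ℤ → ℂ) p := by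
  simp only [casorati_cons, sub_mul, Finset.sum_sub_distrib, Finset.sum_mul, Finset.mul_sum]
  rw [Finset.sum_comm]
  simp only [mul_assoc]

theorem casorati_cons_congr {m : ℕ} (φ : Fin m → ℤ → ℂ) {f g : ℤ → ℂ} {p : ℤ}
    (h : ∀ k, p - m ≤ k → k ≤ p → f k = g k) :
    casorati (Fin.cons f φ : Fin (m + 1) → ℤ → ℂ) p =
      casorati (Fin.cons g φ : Fin (m + 1) → ℤ → ℂ) p := by
  simp only [casorati_cons]
  refine Finset.sum_congr rfl fun j _ => ?_
  rw [h _ (by omega) (by omega)]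

theorem casorati_cons_const_mul {m : ℕ} (φ : Fin m → ℤ → ℂ) (c : ℂ) (f : ℤ → ℂ) (p : ℤ) :
    casorati (Fin.cons (fun k => c * f k) φ : Fin (m + 1) → ℤ → ℂ) p =
      c * casorati (Fin.cons f φ : Fin (m + 1) → ℤ → ℂ) p := by
  simp only [casorati_cons, Finset.mul_sum, mul_assoc]

/-- The Darboux transform of a second order difference operator by an invariant space of sequences
satisfies a three term relation again. -/
theorem exists_casorati_triOp {m : ℕ} (φ : Fin m → ℤ → ℂ) (A B C : ℤ → ℂ) (p : ℤ)
    (hinv : ∀ i, ∃ (μ η : ℂ) (l : Fin m), ∀ k, p - m ≤ k → k ≤ p →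
      triOp A B C (φ i) k = μ * φ i k + η * φ l k)
    (h1 : casorati φ (p - 1) ≠ 0) (h0 : casorati φ p ≠ 0) :
    ∃ β : ℂ, ∀ f : ℤ → ℂ,
      casorati (Fin.cons (triOp A B C f) φ : Fin (m + 1) → ℤ → ℂ) p =
        A p * casorati φ (p - 1) / casorati φ p *
            casorati (Fin.cons f φ : Fin (m + 1) → ℤ → ℂ) (p + 1) +
          β * casorati (Fin.cons f φ : Fin (m + 1) → ℤ → ℂ) p +
          C (p - m) * casorati φ p / casorati φ (p - 1) *
            casorati (Fin.cons f φ : Fin (m + 1) → ℤ → ℂ) (p - 1) := by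
  set K : ℂ := ∑ j : Fin (m + 1), if (j : ℕ) = 1 then A (p - 1) * casoratiCofactor φ p j else 0
    with hK
  set K' : ℂ := ∑ j : Fin (m + 1), if (j : ℕ) = 1 then casoratiCofactor φ (p + 1) j else 0 with hK'
  refine ⟨B p + (K - A p * casorati φ (p - 1) / casorati φ p * K') / casorati φ (p - 1), ?_⟩
  -- sequences vanishing at the inner positions
  have key : ∀ f : ℤ → ℂ, (∀ k, p - m ≤ k → k < p → f k = 0) →
      casorati (Fin.cons (triOp A B C f) φ : Fin (m + 1) → ℤ → ℂ) p =
        A p * casorati φ (p - 1) / casorati φ p *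
            casorati (Fin.cons f φ : Fin (m + 1) → ℤ → ℂ) (p + 1) +
          (B p + (K - A p * casorati φ (p - 1) / casorati φ p * K') / casorati φ (p - 1)) *
            casorati (Fin.cons f φ : Fin (m + 1) → ℤ → ℂ) p +
          C (p - m) * casorati φ p / casorati φ (p - 1) *
            casorati (Fin.cons f φ : Fin (m + 1) → ℤ → ℂ) (p - 1) := by
    intro f hf
    have e1 : casorati (Fin.cons f φ : Fin (m + 1) → ℤ → ℂ) p = f p * casorati φ (p - 1) := by
      rw [casorati_cons, Finset.sum_eq_single 0, casoratiCofactor_zero]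
      · simp
      · intro j _ hj
        have : (j : ℕ) ≠ 0 := fun h => hj (Fin.ext h)
        rw [hf _ (by omega) (by omega), zero_mul]
      · simp
    have e2 : casorati (Fin.cons f φ : Fin (m + 1) → ℤ → ℂ) (p - 1) =
        f (p - m - 1) * ((-1) ^ m * casorati φ (p - 1)) := by
      rw [casorati_cons, Finset.sum_eq_single (Fin.last m), casoratiCofactor_last]
      · rw [Fin.val_last, show p - 1 - (m : ℤ) = p - m - 1 by ring]
      · intro j _ hj
        have : (j : ℕ) ≠ m := fun h => hj (Fin.ext h)
        rw [hf _ (by omega) (by omega), zero_mul]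
      · simp
    have e3 : casorati (Fin.cons f φ : Fin (m + 1) → ℤ → ℂ) (p + 1) =
        f (p + 1) * casorati φ p + f p * K' := by
      have : ∀ j : Fin (m + 1), f (p + 1 - (j : ℕ)) * casoratiCofactor φ (p + 1) j =
          (if j = 0 then f (p + 1) * casorati φ p else 0) +
            f p * (if (j : ℕ) = 1 then casoratiCofactor φ (p + 1) j else 0) := by
        intro j
        by_cases hj0 : j = 0
        · rw [hj0, casoratiCofactor_zero]
          simp
        · have hj0' : (j : ℕ) ≠ 0 := fun h => hj0 (Fin.ext h)
          rw [if_neg hj0]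
          by_cases hj1 : (j : ℕ) = 1
          · rw [if_pos hj1, hj1]
            simp
          · rw [if_neg hj1, hf _ (by omega) (by omega)]
            simp
      rw [casorati_cons, Finset.sum_congr rfl fun j _ => this j, Finset.sum_add_distrib,
        ← Finset.mul_sum, ← hK', Finset.sum_ite_eq' Finset.univ (0 : Fin (m + 1)),
        if_pos (Finset.mem_univ _)]
    have e4 : casorati (Fin.cons (triOp A B C f) φ : Fin (m + 1) → ℤ → ℂ) p =
        (A p * f (p + 1) + B p * f p) * casorati φ (p - 1) + f p * K +
          C (p - m) * f (p - m - 1) * ((-1) ^ m * casorati φ p) := by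
      have : ∀ j : Fin (m + 1), triOp A B C f (p - (j : ℕ)) * casoratiCofactor φ p j =
          (if j = 0 then (A p * f (p + 1) + B p * f p) * casorati φ (p - 1) else 0) +
            f p * (if (j : ℕ) = 1 then A (p - 1) * casoratiCofactor φ p j else 0) +
            (if j = Fin.last m then C (p - m) * f (p - m - 1) * ((-1) ^ m * casorati φ p)
              else 0) := by
        intro j
        have t0 : (if j = 0 then (A p * f (p + 1) + B p * f p) * casorati φ (p - 1) else 0) =
            (if (j : ℕ) = 0 then A p * f (p + 1) + B p * f p else 0) * casoratiCofactor φ p j := by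
          by_cases hj : j = 0
          · rw [hj, casoratiCofactor_zero]
            simp
          · have hj' : (j : ℕ) ≠ 0 := fun h => hj (Fin.ext h)
            rw [if_neg hj, if_neg hj', zero_mul]
        have t1 : (if j = Fin.last m then C (p - m) * f (p - m - 1) * ((-1) ^ m * casorati φ p)
            else 0) =
            (if (j : ℕ) = m then C (p - m) * f (p - m - 1) else 0) * casoratiCofactor φ p j := by
          by_cases hj : j = Fin.last m
          · rw [hj, casoratiCofactor_last]
            simp
          · have hj' : (j : ℕ) ≠ m := fun h => hj (Fin.ext h)
            rw [if_neg hj, if_neg hj', zero_mul]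
        have t2 : f p * (if (j : ℕ) = 1 then A (p - 1) * casoratiCofactor φ p j else 0) =
            (if (j : ℕ) = 1 then A (p - 1) * f p else 0) * casoratiCofactor φ p j := by
          split_ifs <;> ring
        rw [t0, t1, t2, ← add_mul, ← add_mul]
        congr 1
        unfold triOp
        have u1 : A (p - (j : ℕ)) * f (p - (j : ℕ) + 1) =
            (if (j : ℕ) = 0 then A p * f (p + 1) else 0) +
              (if (j : ℕ) = 1 then A (p - 1) * f p else 0) := by
          by_cases hj0 : (j : ℕ) = 0
          · simp [hj0]
          · by_cases hj1 : (j : ℕ) = 1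
            · simp [hj1]
            · rw [hf _ (by omega) (by omega), if_neg hj0, if_neg hj1]
              simp
        have u2 : B (p - (j : ℕ)) * f (p - (j : ℕ)) = if (j : ℕ) = 0 then B p * f p else 0 := by
          by_cases hj0 : (j : ℕ) = 0
          · simp [hj0]
          · rw [hf _ (by omega) (by omega), if_neg hj0, mul_zero]
        have u3 : C (p - (j : ℕ)) * f (p - (j : ℕ) - 1) =
            if (j : ℕ) = m then C (p - m) * f (p - m - 1) else 0 := by
          by_cases hjm : (j : ℕ) = m
          · simp [hjm]
          · rw [hf _ (by omega) (by omega), if_neg hjm, mul_zero]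
        rw [u1, u2, u3]
        split_ifs <;> ring
      rw [casorati_cons, Finset.sum_congr rfl fun j _ => this j, Finset.sum_add_distrib,
        Finset.sum_add_distrib, ← Finset.mul_sum, ← hK,
        Finset.sum_ite_eq' Finset.univ (0 : Fin (m + 1)),
        Finset.sum_ite_eq' Finset.univ (Fin.last m), if_pos (Finset.mem_univ _),
        if_pos (Finset.mem_univ _)]
    rw [e1, e2, e3, e4]
    field_simp
    ring
  intro f
  set X : Matrix (Fin m) (Fin m) ℂ := Matrix.of fun i j : Fin m => φ i (p - 1 - (j : ℕ)) with hX
  have hXu : IsUnit X.det := isUnit_iff_ne_zero.2 h1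
  set t : Fin m → ℂ := Matrix.vecMul (fun j : Fin m => f (p - 1 - (j : ℕ))) X⁻¹ with ht
  have htX : Matrix.vecMul t X = fun j : Fin m => f (p - 1 - (j : ℕ)) := by
    rw [ht, Matrix.vecMul_vecMul, Matrix.nonsing_inv_mul _ hXu, Matrix.vecMul_one]
  have hvan : ∀ k, p - m ≤ k → k < p → f k - ∑ i, t i * φ i k = 0 := by
    intro k hk1 hk2
    have := congrFun htX ⟨(p - 1 - k).toNat, by omega⟩
    simp only [Matrix.vecMul, dotProduct, hX, Matrix.of_apply] at this
    rw [show p - 1 - (((p - 1 - k).toNat : ℕ) : ℤ) = k by omega] at this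
    rw [this, sub_self]
  have hk := key (fun k => f k - ∑ i, t i * φ i k) hvan
  have hzero : ∀ i, casorati (Fin.cons (triOp A B C (φ i)) φ : Fin (m + 1) → ℤ → ℂ) p = 0 := by
    intro i
    obtain ⟨μ, η, l, h⟩ := hinv i
    rw [casorati_cons_congr φ h]
    have e1 := casorati_cons_self φ i p
    have e2 := casorati_cons_self φ l p
    simp only [casorati_cons] at e1 e2 ⊢
    simp only [add_mul, Finset.sum_add_distrib, mul_assoc, ← Finset.mul_sum]
    rw [e1, e2]
    ring
  have htri : triOp A B C (fun k => f k - ∑ i, t i * φ i k) =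
      fun k => triOp A B C f k - ∑ i, t i * triOp A B C (φ i) k := by
    funext k
    simp only [triOp, mul_add, Finset.sum_add_distrib, mul_sub, Finset.mul_sum]
    simp only [mul_left_comm]
    ring
  rw [htri] at hk
  simpa only [casorati_cons_sub_sum, casorati_cons_self, hzero, mul_zero, Finset.sum_const_zero,
    sub_zero] using hk

/-- The sequences entering the determinants `Φ_n` and `D_n`, gauged so that they are generalised
eigenfunctions of the recurrence operator of the dual Hahn polynomials at positions `k > k₀`. -/
def gaugedRow (a b N : ℕ) (M : ℕ → ℝ) {nU : ℕ} (u : Fin nU → ℂ) (k₀ : ℤ) (i : Fin (a + nU))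
    (k : ℤ) : ℂ :=
  if h : (i : ℕ) < a then
    (((-1 : ℝ) ^ (k - k₀).toNat * poch ((b : ℝ) + N - k + 1) (k - k₀).toNat *
      W a b (N : ℝ) M (b + (i : ℕ)) (-(k : ℝ) - 1) : ℝ) : ℂ)
  else dualHahnC (a : ℂ) (b : ℂ) (N : ℂ) k
    (lamC a b (u ⟨(i : ℕ) - a, by have := i.isLt; omega⟩))

/-- The recurrence operator of the dual Hahn polynomials. -/
def dualHahnOp (a b N : ℕ) : (ℤ → ℂ) → ℤ → ℂ :=
  triOp (fun k => k + 1) (fun k => dualHahnDiag a b N k) (fun k => dualHahnLower a b N k)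

theorem dualHahnOp_dualHahnC (a b N : ℕ) (x : ℂ) :
    dualHahnOp a b N (fun k => dualHahnC a b N k x) = fun k => x * dualHahnC a b N k x := by
  funext k
  exact (mul_dualHahnC a b N k x).symm

/-- The gauge turns the Hahn difference operator into the recurrence operator of the dual Hahn
polynomials. -/
theorem dualHahnOp_gauge (a b N : ℕ) (w : ℝ → ℝ) (k₀ : ℤ) {k : ℤ} (hk : k₀ < k) :
    dualHahnOp a b N (fun k => (((-1 : ℝ) ^ (k - k₀).toNat *
      poch ((b : ℝ) + N - k + 1) (k - k₀).toNat * w (-(k : ℝ) - 1) : ℝ) : ℂ)) k =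
    (((-1 : ℝ) ^ (k - k₀).toNat * poch ((b : ℝ) + N - k + 1) (k - k₀).toNat *
      (hahnOp (-a) (-b) (-2 - N) w (-(k : ℝ) - 1) - (a + b) * w (-(k : ℝ) - 1)) : ℝ) : ℂ) := by
  obtain ⟨d, rfl⟩ : ∃ d : ℕ, k = k₀ + d + 1 := ⟨(k - k₀ - 1).toNat, by omega⟩
  simp only [dualHahnOp, triOp, dualHahnDiag, dualHahnLower, hahnOp]
  rw [show (k₀ + d + 1 + 1 - k₀).toNat = d + 2 by omega,
    show (k₀ + d + 1 - k₀).toNat = d + 1 by omega,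
    show (k₀ + d + 1 - 1 - k₀).toNat = d by omega,
    poch_succ_left _ (d + 1), poch_succ_left _ d]
  have e1 : (b : ℝ) + N - ((k₀ + d + 1 + 1 : ℤ) : ℝ) + 1 + 1 = b + N - k₀ - d := by
    push_cast; ring
  have e2 : (b : ℝ) + N - ((k₀ + d + 1 : ℤ) : ℝ) + 1 = b + N - k₀ - d := by push_cast; ring
  have e3 : (b : ℝ) + N - ((k₀ + d + 1 - 1 : ℤ) : ℝ) + 1 = b + N - k₀ - d + 1 := by
    push_cast; ring
  have e4 : -((k₀ + d + 1 + 1 : ℤ) : ℝ) - 1 = -((k₀ + d + 1 : ℤ) : ℝ) - 1 - 1 := by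
    push_cast; ring
  have e5 : -((k₀ + d + 1 - 1 : ℤ) : ℝ) - 1 = -((k₀ + d + 1 : ℤ) : ℝ) - 1 + 1 := by
    push_cast; ring
  rw [e1, e2, e3, e4, e5, poch_succ_left _ d]
  push_cast
  ring

theorem exists_dualHahnOp_gaugedRow (a b N : ℕ) (M : ℕ → ℝ) {nU : ℕ} (u : Fin nU → ℂ) (k₀ : ℤ)
    (i : Fin (a + nU)) :
    ∃ (μ η : ℂ) (l : Fin (a + nU)), ∀ k, k₀ < k →
      dualHahnOp a b N (gaugedRow a b N M u k₀ i) k =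
        μ * gaugedRow a b N M u k₀ i k + η * gaugedRow a b N M u k₀ l k := by
  by_cases hi : (i : ℕ) < a
  · obtain ⟨μ, η, l, hl, h⟩ := exists_hahnOp_W N M hi (b := b)
    refine ⟨(μ - (a + b) : ℝ), η, ⟨l, by omega⟩, fun k hk => ?_⟩
    have hrow : ∀ (j : Fin (a + nU)), (j : ℕ) < a → gaugedRow a b N M u k₀ j =
        fun k => (((-1 : ℝ) ^ (k - k₀).toNat * poch ((b : ℝ) + N - k + 1) (k - k₀).toNat *
          W a b (N : ℝ) M (b + (j : ℕ)) (-(k : ℝ) - 1) : ℝ) : ℂ) := fun j hj => by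
      funext k
      rw [gaugedRow, dif_pos hj]
    rw [hrow i hi, hrow ⟨l, by omega⟩ hl, dualHahnOp_gauge a b N _ k₀ hk, h]
    push_cast
    ring
  · have hrow : gaugedRow a b N M u k₀ i = fun k => dualHahnC a b N k
        (lamC a b (u ⟨(i : ℕ) - a, by have := i.isLt; omega⟩)) := by
      funext k
      rw [gaugedRow, dif_neg hi]
    refine ⟨lamC a b (u ⟨(i : ℕ) - a, by have := i.isLt; omega⟩), 0, i, fun k _ => ?_⟩
    rw [hrow, dualHahnOp_dualHahnC, zero_mul, add_zero]

theorem det_of_mul_mul {m : ℕ} (r c : Fin m → ℂ) (X : Fin m → Fin m → ℂ) :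
    Matrix.det (Matrix.of fun i j => r i * (c j * X i j)) =
      (∏ i, r i) * ((∏ j, c j) * Matrix.det (Matrix.of X)) := by
  have h1 := Matrix.det_mul_column r (Matrix.of fun i j => c j * X i j)
  have h2 := Matrix.det_mul_row c (Matrix.of X)
  simp only [Matrix.of_apply] at h1 h2
  rw [h1, h2]

theorem prod_ite_lt_left (a m : ℕ) (c : ℂ) :
    (∏ i : Fin (a + m), if (i : ℕ) < a then c else 1) = c ^ a := by
  rw [Fin.prod_univ_add]
  simp

/-- The scalar relating the determinants `Φ_n`, `D_n` to Casorati determinants. -/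
def gaugeFactor (a b N nU : ℕ) (n d : ℕ) : ℂ :=
  ((((-1 : ℝ) ^ (d + a + nU) * poch ((b : ℝ) + N - n + a + 1) d : ℝ) : ℂ)) ^ a *
    ∏ j : Fin (a + nU + 1), (-1) ^ (j : ℕ)

theorem gauge_split (a b N nU n d : ℕ) {j : ℕ} (hj : j ≤ a + nU) :
    (-1 : ℝ) ^ (d + (a + nU - j)) *
        poch ((b : ℝ) + N - n - nU + j + 1) (d + (a + nU - j)) =
      (-1 : ℝ) ^ (d + a + nU) * poch ((b : ℝ) + N - n + a + 1) d * ((-1) ^ j *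
        poch ((b : ℝ) + N - n - nU + j + 1) (a + nU - j)) := by
  obtain ⟨e, he⟩ := Nat.exists_eq_add_of_le hj
  have hs : (-1 : ℝ) ^ (d + a + nU) * (-1) ^ j = (-1) ^ (d + e) := by
    rw [add_assoc d, he, ← pow_add, show d + (j + e) + j = d + e + 2 * j by ring, pow_add, pow_mul]
    norm_num
  have hc : (a : ℝ) + nU = j + e := by exact_mod_cast he
  rw [show a + nU - j = e by omega, add_comm d e, poch_add,
    show (b : ℝ) + N - n - nU + j + 1 + e = b + N - n + a + 1 by linarith, add_comm e d, ← hs]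
  ring

theorem casorati_cons_gaugedRow (a b N : ℕ) (M : ℕ → ℝ) {nU : ℕ} (u : Fin nU → ℂ) (k₀ : ℤ)
    {n d : ℕ} (hd : (n : ℤ) - a = k₀ + d) (x : ℂ) :
    casorati (Fin.cons (fun k => dualHahnC a b N k x) (gaugedRow a b N M u k₀) :
      Fin (a + nU + 1) → ℤ → ℂ) (n + nU) = gaugeFactor a b N nU n d * DU a b N M u n x := by
  set ρ : ℂ := (((-1 : ℝ) ^ (d + a + nU) * poch ((b : ℝ) + N - n + a + 1) d : ℝ) : ℂ) with hρ
  have hr : (∏ i : Fin (a + nU + 1), (Fin.cons 1 fun i : Fin (a + nU) =>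
      if (i : ℕ) < a then ρ else 1 : Fin (a + nU + 1) → ℂ) i) = ρ ^ a := by
    rw [Fin.prod_univ_succ]
    simp only [Fin.cons_zero, Fin.cons_succ, one_mul]
    exact prod_ite_lt_left a nU ρ
  rw [gaugeFactor, ← hρ, ← hr, mul_assoc, DU, ← det_of_mul_mul, casorati]
  congr 1
  ext i j
  have hj : (j : ℕ) ≤ a + nU := by have := j.isLt; omega
  have hsq : ((-1 : ℂ) ^ (j : ℕ)) * (-1) ^ (j : ℕ) = 1 := by
    rw [← mul_pow]; norm_num
  simp only [Matrix.of_apply]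
  refine Fin.cases ?_ (fun i => ?_) i
  · simp only [Fin.cons_zero]
    rw [dif_pos (Fin.val_zero _), ← mul_assoc, ← mul_assoc, one_mul, hsq, one_mul]
  · simp only [Fin.cons_succ, Fin.val_succ]
    rw [dif_neg (Nat.succ_ne_zero _), gaugedRow]
    by_cases hi : (i : ℕ) < a
    · rw [dif_pos hi, dif_pos (by omega), if_pos hi, hρ]
      have hk : ((n : ℤ) + nU - (j : ℕ) - k₀).toNat = d + (a + nU - j) := by omega
      rw [hk, show b + ((i : ℕ) + 1) - 1 = b + i by omega]
      have e1 : (b : ℝ) + N - (((n : ℤ) + nU - (j : ℕ) : ℤ) : ℝ) + 1 =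
          b + N - n - nU + (j : ℕ) + 1 := by push_cast; ring
      have e2 : -(((n : ℤ) + nU - (j : ℕ) : ℤ) : ℝ) - 1 = -(n : ℝ) - nU + (j : ℕ) - 1 := by
        push_cast; ring
      rw [e1, e2, gauge_split a b N nU n d hj]
      push_cast
      ring
    · rw [dif_neg hi, dif_neg (by omega), if_neg hi, one_mul, ← mul_assoc, hsq, one_mul]
      congr 4
      omega

theorem casorati_gaugedRow (a b N : ℕ) (M : ℕ → ℝ) {nU : ℕ} (u : Fin nU → ℂ) (k₀ : ℤ)
    {n d : ℕ} (hd : (n : ℤ) - a = k₀ + d) :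
    casorati (gaugedRow a b N M u k₀) (n + nU - 1) =
      gaugeFactor a b N nU n d * PhiU a b N M u n := by
  set ρ : ℂ := (((-1 : ℝ) ^ (d + a + nU) * poch ((b : ℝ) + N - n + a + 1) d : ℝ) : ℂ) with hρ
  have hc : (∏ j : Fin (a + nU + 1), (-1 : ℂ) ^ (j : ℕ)) =
      ∏ j : Fin (a + nU), (-1 : ℂ) ^ ((j : ℕ) + 1) := by
    rw [Fin.prod_univ_succ]
    simp
  rw [gaugeFactor, ← hρ, ← prod_ite_lt_left a nU ρ, hc, mul_assoc, PhiU, ← det_of_mul_mul,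
    casorati]
  congr 1
  ext i j
  have hj : (j : ℕ) + 1 ≤ a + nU := j.isLt
  have hsq : ((-1 : ℂ) ^ ((j : ℕ) + 1)) * (-1) ^ ((j : ℕ) + 1) = 1 := by
    rw [← mul_pow]; norm_num
  simp only [Matrix.of_apply]
  rw [gaugedRow]
  have hp : (n : ℤ) + nU - 1 - (j : ℕ) = n + nU - (j : ℕ) - 1 := by ring
  by_cases hi : (i : ℕ) < a
  · rw [dif_pos hi, dif_pos hi, if_pos hi, hρ]
    have hk : ((n : ℤ) + nU - 1 - (j : ℕ) - k₀).toNat = d + (a + nU - (j + 1)) := by omega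
    rw [hk]
    have e1 : (b : ℝ) + N - (((n : ℤ) + nU - 1 - (j : ℕ) : ℤ) : ℝ) + 1 =
        b + N - n - nU + ((j + 1 : ℕ) : ℝ) + 1 := by push_cast; ring
    have e2 : -(((n : ℤ) + nU - 1 - (j : ℕ) : ℤ) : ℝ) - 1 = -(n : ℝ) - nU + (j : ℕ) := by
      push_cast; ring
    have e3 : (b : ℝ) + N - n - nU + ((j + 1 : ℕ) : ℝ) + 1 =
        (b : ℝ) + N - n - nU + (j : ℕ) + 2 := by push_cast; ring
    rw [e1, e2, gauge_split a b N nU n d hj, e3, show a + nU - (j : ℕ) - 1 = a + nU - (j + 1) by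
      omega]
    push_cast
    ring
  · rw [dif_neg hi, dif_neg hi, if_neg hi, one_mul, ← mul_assoc, hsq, one_mul, hp]

/-- Corollary 5.2: three term recurrence formula for the polynomials `q_n^{a,b,N;𝓜,U}`. -/
theorem duran_cor5_2 (a b N : ℕ) (M : ℕ → ℝ) {nU : ℕ} (u : Fin nU → ℂ)
    (hb : 1 ≤ b) (hba : b ≤ a) (haN : a ≤ N)
    (hM : ∀ i, i < b → M i ≠ 0 ∧ M i ≠ 1)
    (hu : Function.Injective u)
    (huv : ∀ k l, u k + u l ≠ -(a : ℂ) - b - 1)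
    (hnS : 0 < nSU a b N u)
    (hPhi : ∀ n, n ≤ nSU a b N u → PhiU a b N M u n ≠ 0) :
    ∃ bn : ℕ → ℂ, ∀ n, 1 ≤ n → n ≤ nSU a b N u - 2 → ∀ x : ℂ,
      x * qU a b N M u n x =
        ((n : ℂ) + 1 + nU) * PhiU a b N M u n / PhiU a b N M u (n + 1) *
            qU a b N M u (n + 1) x +
          bn n * qU a b N M u n x +
          (n : ℂ) * ((a : ℂ) + N - n + 1) * ((a : ℂ) + b + N - n + 1) *
              (((a : ℂ) + b + N - n) / ((a : ℂ) + b + N - n + 1)) ^ a *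
              PhiU a b N M u (n + 1) / PhiU a b N M u n *
            qU a b N M u (n - 1) x := by
  suffices h : ∀ n, 1 ≤ n → n ≤ nSU a b N u - 2 → ∃ β : ℂ, ∀ x : ℂ,
      x * DU a b N M u n x =
        ((n : ℂ) + 1 + nU) * PhiU a b N M u n / PhiU a b N M u (n + 1) * DU a b N M u (n + 1) x +
          β * DU a b N M u n x +
          (n : ℂ) * ((a : ℂ) + N - n + 1) * ((a : ℂ) + b + N - n + 1) *
              (((a : ℂ) + b + N - n) / ((a : ℂ) + b + N - n + 1)) ^ a *
              PhiU a b N M u (n + 1) / PhiU a b N M u n * DU a b N M u (n - 1) x by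
    choose! bn hbn using h
    refine ⟨bn, fun n h1 h2 x => ?_⟩
    simp only [qU]
    rw [mul_div_assoc', hbn n h1 h2 x]
    ring
  intro n hn1 hn2
  have hcard : nSU a b N u ≤ N + b + 1 := by
    refine (Finset.card_filter_le _ _).trans ?_
    rw [Int.card_Icc]
    omega
  obtain ⟨n, rfl⟩ : ∃ n', n = n' + 1 := ⟨n - 1, by omega⟩
  rw [Nat.add_sub_cancel]
  set k₀ : ℤ := n - a with hk₀
  set φ := gaugedRow a b N M u k₀ with hφ
  set T₀ := gaugeFactor a b N nU n 0 with hT₀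
  set T₁ := gaugeFactor a b N nU (n + 1) 1 with hT₁
  set T₂ := gaugeFactor a b N nU (n + 1 + 1) 2 with hT₂
  set Φ₁ := PhiU a b N M u (n + 1) with hΦ₁
  set Φ₂ := PhiU a b N M u (n + 1 + 1) with hΦ₂
  have hΦ₁0 : Φ₁ ≠ 0 := hPhi _ (by omega)
  have hΦ₂0 : Φ₂ ≠ 0 := hPhi _ (by omega)
  set p : ℤ := ((n + 1 : ℕ) : ℤ) + nU with hp
  have c1 : casorati φ (p - 1) = T₁ * Φ₁ :=
    casorati_gaugedRow a b N M u k₀ (n := n + 1) (d := 1) (by push_cast; ring)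
  have c2 : casorati φ p = T₂ * Φ₂ := by
    have := casorati_gaugedRow a b N M u k₀ (n := n + 1 + 1) (d := 2) (by push_cast; ring)
    rwa [show ((n + 1 + 1 : ℕ) : ℤ) + nU - 1 = p by push_cast [hp]; ring] at this
  have d0 := casorati_cons_gaugedRow a b N M u k₀ (n := n) (d := 0) (by push_cast; ring)
  have d1 := casorati_cons_gaugedRow a b N M u k₀ (n := n + 1) (d := 1) (by push_cast; ring)
  have d2 := casorati_cons_gaugedRow a b N M u k₀ (n := n + 1 + 1) (d := 2) (by push_cast; ring)
  rw [show (n : ℤ) + nU = p - 1 by push_cast [hp]; ring] at d0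
  rw [show ((n + 1 + 1 : ℕ) : ℤ) + nU = p + 1 by push_cast [hp]; ring] at d2
  -- the gauge constants
  set g : ℂ := (a : ℂ) + b + N - (n + 1 : ℕ) with hg
  have hgpos : n + 1 < a + b + N := by omega
  have hg0 : g ≠ 0 := by
    have : g = ((a + b + N - (n + 1) : ℕ) : ℂ) := by
      rw [Nat.cast_sub hgpos.le]
      push_cast [hg]
      ring
    rw [this]
    exact_mod_cast (by omega : a + b + N - (n + 1) ≠ 0)
  have hg1 : g + 1 ≠ 0 := by
    have : g + 1 = ((a + b + N - (n + 1) + 1 : ℕ) : ℂ) := by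
      rw [Nat.cast_add, Nat.cast_sub hgpos.le]
      push_cast [hg]
      ring
    rw [this]
    exact_mod_cast Nat.succ_ne_zero (a + b + N - (n + 1))
  set S : ℂ := ∏ j : Fin (a + nU + 1), (-1) ^ (j : ℕ) with hS
  have hS0 : S ≠ 0 := Finset.prod_ne_zero_iff.2 fun j _ => pow_ne_zero _ (by norm_num)
  set ε : ℂ := (-1) ^ (a + nU) with hε
  have hε0 : ε ≠ 0 := pow_ne_zero _ (by norm_num)
  have t0 : T₀ = ε ^ a * S := by
    rw [hT₀, gaugeFactor, poch_zero, ← hS, hε]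
    simp
  have t1 : T₁ = (-ε * (g + 1)) ^ a * S := by
    rw [hT₁, gaugeFactor, poch_succ, poch_zero, ← hS, hε, hg]
    congr 2
    push_cast
    ring
  have t2 : T₂ = (ε * (g * (g + 1))) ^ a * S := by
    rw [hT₂, gaugeFactor, poch_succ, poch_succ, poch_zero, ← hS, hε, hg]
    congr 2
    push_cast
    ring
  have hT₁0 : T₁ ≠ 0 := by
    rw [t1]
    exact mul_ne_zero (pow_ne_zero _ (mul_ne_zero (neg_ne_zero.2 hε0) hg1)) hS0
  have hT₂0 : T₂ ≠ 0 := by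
    rw [t2]
    exact mul_ne_zero (pow_ne_zero _ (mul_ne_zero hε0 (mul_ne_zero hg0 hg1))) hS0
  have hT : T₂ * T₀ = T₁ * T₁ * (g / (g + 1)) ^ a := by
    have : ε * (g * (g + 1)) * ε = -ε * (g + 1) * (-ε * (g + 1)) * (g / (g + 1)) := by
      field_simp
    rw [t0, t1, t2]
    calc (ε * (g * (g + 1))) ^ a * S * (ε ^ a * S)
        = (ε * (g * (g + 1)) * ε) ^ a * S * S := by rw [mul_pow _ ε]; ring
      _ = _ := by rw [this, mul_pow, mul_pow]; ring
  obtain ⟨β, hβ⟩ := exists_casorati_triOp φ (fun k => k + 1) (fun k => dualHahnDiag a b N k)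
    (fun k => dualHahnLower a b N k) p (fun i => by
      obtain ⟨μ, η, l, h⟩ := exists_dualHahnOp_gaugedRow a b N M u k₀ i
      exact ⟨μ, η, l, fun k hk _ => h k (by push_cast at hk; omega)⟩)
    (by rw [c1]; exact mul_ne_zero hT₁0 hΦ₁0) (by rw [c2]; exact mul_ne_zero hT₂0 hΦ₂0)
  refine ⟨β, fun x => ?_⟩
  have hx := hβ fun k => dualHahnC a b N k x
  have hop := dualHahnOp_dualHahnC a b N x
  rw [dualHahnOp] at hop
  rw [hop, casorati_cons_const_mul, d0, d1, d2, c1, c2] at hx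
  have hA : ((p : ℤ) : ℂ) + 1 = ((n + 1 : ℕ) : ℂ) + 1 + nU := by
    push_cast [hp]
    ring
  have hC : dualHahnLower a b N ((p - (a + nU : ℕ) : ℤ) : ℂ) =
      ((n + 1 : ℕ) : ℂ) * ((a : ℂ) + N - (n + 1 : ℕ) + 1) * (g + 1) := by
    rw [dualHahnLower, hg]
    push_cast [hp]
    ring
  rw [hA, hC] at hx
  apply mul_left_cancel₀ hT₁0
  rw [mul_left_comm, hx]
  have hthird : T₂ * Φ₂ / (T₁ * Φ₁) * T₀ = T₁ * ((g / (g + 1)) ^ a * Φ₂ / Φ₁) := by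
    rw [div_mul_eq_mul_div, div_eq_iff (mul_ne_zero hT₁0 hΦ₁0),
      show T₂ * Φ₂ * T₀ = T₂ * T₀ * Φ₂ by ring, hT]
    field_simp
  have hfirst : T₁ * Φ₁ / (T₂ * Φ₂) * T₂ = T₁ * (Φ₁ / Φ₂) := by
    field_simp
  linear_combination (((n + 1 : ℕ) : ℂ) + 1 + nU) * DU a b N M u (n + 1 + 1) x * hfirst +
    ((n + 1 : ℕ) : ℂ) * ((a : ℂ) + N - (n + 1 : ℕ) + 1) * (g + 1) * DU a b N M u n x * hthird
end
end

section
/- Let a, b, N be integers with 1 ≤ b ≤ a and N ≥ 0. For every integer g with a ≤ g ≤ a+b−1, the Hahn polynomial h_g^{−a,−b,−2−N} vanishes identically: h_g^{−a,−b,−2−N}(x) = 0 for all real x. -/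
noncomputable section

open Finset

/-- The Pochhammer symbol `(-k)_m` vanishes for natural numbers `k < m`. -/
theorem poch_eq_zero_of_eq_neg {x : ℝ} {k m : ℕ} (hx : x = -(k : ℝ)) (hk : k < m) :
    poch x m = 0 :=
  Finset.prod_eq_zero (Finset.mem_range.mpr hk) (by rw [hx, neg_add_cancel])

/-- For `a ≤ g ≤ a+b-1`, the Hahn polynomial `h_g^{-a,-b,-2-N}` vanishes identically. -/
theorem duran_hahn_vanishes (a b N : ℕ)
    (hb : 1 ≤ b) (hba : b ≤ a) :
    ∀ g : ℕ, a ≤ g → g ≤ a + b - 1 → ∀ x : ℝ,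
      hahn (-(a : ℝ)) (-(b : ℝ)) (-2 - (N : ℝ)) g x = 0 := by
  intro g hag hgab x
  refine Finset.sum_eq_zero fun j hj => ?_
  rw [Finset.mem_range] at hj
  rcases lt_or_ge j a with hja | haj
  · obtain ⟨k, rfl⟩ := Nat.exists_eq_add_of_lt hja
    rw [poch_eq_zero_of_eq_neg (k := k) (x := -((j + k + 1 : ℕ) : ℝ) + j + 1)
      (by push_cast; ring) (by omega)]
    simp
  · obtain ⟨k, hk⟩ := Nat.exists_eq_add_of_lt (show g < a + b by omega)
    have hkR : (a : ℝ) + b = g + k + 1 := by exact_mod_cast hk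
    rw [poch_eq_zero_of_eq_neg (k := k) (x := -(a : ℝ) + -(b : ℝ) + g + 1)
      (by linarith) (by omega)]
    simp
end
end
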